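/- Let Φ be the standard normal cumulative distribution function with density Φ′, and define ψ(a) = Φ′(a) + a·Φ(a). Then lim_{a→−∞} ψ(a) / (a^{−2}·Φ′(a)) = 1. -/

import Mathlib

open MeasureTheory ProbabilityTheory Filter

noncomputable section

/-- The standard normal density `Φ′(a) = (2π)^{−1/2} e^{−a²/2}`. -/
def stdGaussPdf (a : ℝ) : ℝ := (Real.sqrt (2 * Real.pi))⁻¹ * Real.exp (-a ^ 2 / 2)

/-- The standard normal cumulative distribution function
`Φ(a) = ∫_{−∞}^a (2π)^{−1/2} e^{−u²/2} du`. -/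
def stdGaussCdf (a : ℝ) : ℝ := ∫ u in Set.Iic a, stdGaussPdf u

/-- `ψ(a) = Φ′(a) + a·Φ(a)`. -/
def psi (a : ℝ) : ℝ := stdGaussPdf a + a * stdGaussCdf a

lemma continuous_stdGaussPdf : Continuous stdGaussPdf := by
  unfold stdGaussPdf
  fun_prop

lemma stdGaussPdf_pos (a : ℝ) : 0 < stdGaussPdf a := by
  unfold stdGaussPdf
  positivity

lemma integrable_stdGaussPdf : Integrable stdGaussPdf := by
  have h := (integrable_exp_neg_mul_sq (b := 1 / 2) (by norm_num)).const_mul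
    (Real.sqrt (2 * Real.pi))⁻¹
  refine h.congr (ae_of_all _ fun x => ?_)
  simp only [stdGaussPdf]
  congr 2
  ring

lemma hasDerivAt_stdGaussPdf (a : ℝ) : HasDerivAt stdGaussPdf (-a * stdGaussPdf a) a := by
  have h : HasDerivAt (fun x : ℝ => -x ^ 2 / 2) (-a) a := by
    refine ((hasDerivAt_pow 2 a).neg.div_const 2).congr_deriv ?_
    norm_num
    ring
  refine (h.exp.const_mul (Real.sqrt (2 * Real.pi))⁻¹).congr_deriv ?_
  simp only [stdGaussPdf]
  ring

lemma stdGaussCdf_eq (a : ℝ) : stdGaussCdf a = stdGaussCdf 0 + ∫ u in (0 : ℝ)..a, stdGaussPdf u := by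
  have h := intervalIntegral.integral_Iic_sub_Iic (a := 0) (b := a)
    integrable_stdGaussPdf.integrableOn integrable_stdGaussPdf.integrableOn
  simp only [stdGaussCdf]
  linarith

lemma hasDerivAt_stdGaussCdf (a : ℝ) : HasDerivAt stdGaussCdf (stdGaussPdf a) a := by
  rw [funext stdGaussCdf_eq]
  exact (continuous_stdGaussPdf.integral_hasStrictDerivAt 0 a).hasDerivAt.const_add _

lemma tendsto_stdGaussCdf_atBot : Tendsto stdGaussCdf atBot (nhds 0) := by
  have h := intervalIntegral_tendsto_integral_Iic 0
    (integrable_stdGaussPdf.integrableOn (s := Set.Iic 0)) tendsto_id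
  rw [← sub_self (stdGaussCdf 0)]
  refine (h.const_sub (stdGaussCdf 0)).congr fun a => ?_
  rw [stdGaussCdf_eq a, intervalIntegral.integral_symm]
  simp

lemma stdGaussPdf_le (a : ℝ) : stdGaussPdf a ≤ (Real.sqrt (2 * Real.pi))⁻¹ := by
  refine mul_le_of_le_one_right (by positivity) (Real.exp_le_one_iff.2 ?_)
  nlinarith [sq_nonneg a]

lemma tendsto_inv_pow_mul_stdGaussPdf_atBot {n : ℕ} (hn : n ≠ 0) :
    Tendsto (fun a : ℝ => a⁻¹ ^ n * stdGaussPdf a) atBot (nhds 0) := by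
  have h : Tendsto (fun a : ℝ => a⁻¹ ^ n) atBot (nhds 0) := by
    simpa [hn] using (tendsto_inv_atBot_zero (𝕜 := ℝ)).pow n
  refine h.zero_mul_isBoundedUnder_le
    (isBoundedUnder_of ⟨(Real.sqrt (2 * Real.pi))⁻¹, fun a => ?_⟩)
  simpa [abs_of_pos (stdGaussPdf_pos a)] using stdGaussPdf_le a

lemma hasDerivAt_inv_pow_mul_stdGaussPdf (n : ℕ) {a : ℝ} (ha : a ≠ 0) :
    HasDerivAt (fun x : ℝ => x⁻¹ ^ (n + 1) * stdGaussPdf x)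
      (-(a⁻¹ ^ n + (n + 1) * a⁻¹ ^ (n + 2)) * stdGaussPdf a) a := by
  refine (((hasDerivAt_inv ha).pow (n + 1)).mul (hasDerivAt_stdGaussPdf a)).congr_deriv ?_
  simp only [Pi.pow_apply, Nat.add_sub_cancel, inv_pow]
  push_cast
  field_simp
  ring

/-- `lim_{a→−∞} ψ(a)/(a^{−2}·Φ′(a)) = 1`. -/
theorem stmt11 :
    Tendsto (fun a : ℝ => psi a / ((a ^ 2)⁻¹ * stdGaussPdf a)) atBot (nhds 1) := by
  have hlim : Tendsto (fun a : ℝ => (a⁻¹ ^ (0 + 1) * stdGaussPdf a + stdGaussCdf a) /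
      (a⁻¹ ^ (2 + 1) * stdGaussPdf a)) atBot (nhds 1) := by
    refine HasDerivAt.lhopital_zero_atBot
      (f' := fun a => -(a⁻¹ ^ 0 + ((0 : ℕ) + 1) * a⁻¹ ^ (0 + 2)) * stdGaussPdf a + stdGaussPdf a)
      (g' := fun a => -(a⁻¹ ^ 2 + ((2 : ℕ) + 1) * a⁻¹ ^ (2 + 2)) * stdGaussPdf a) ?_ ?_ ?_ ?_ ?_ ?_
    · filter_upwards [eventually_lt_atBot 0] with a ha
      exact (hasDerivAt_inv_pow_mul_stdGaussPdf 0 ha.ne).add (hasDerivAt_stdGaussCdf a)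
    · filter_upwards [eventually_lt_atBot 0] with a ha
      exact hasDerivAt_inv_pow_mul_stdGaussPdf 2 ha.ne
    · filter_upwards [eventually_lt_atBot 0] with a ha
      have hinv : 0 < a⁻¹ ^ 2 := by have := ha.ne; positivity
      have := stdGaussPdf_pos a
      exact mul_ne_zero (neg_ne_zero.2 (by push_cast; positivity)) this.ne'
    · simpa using (tendsto_inv_pow_mul_stdGaussPdf_atBot one_ne_zero).add tendsto_stdGaussCdf_atBot
    · exact tendsto_inv_pow_mul_stdGaussPdf_atBot (by norm_num)
    · have h : Tendsto (fun a : ℝ => (1 + 3 * a⁻¹ ^ 2)⁻¹) atBot (nhds 1) := by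
        simpa using (((tendsto_inv_atBot_zero (𝕜 := ℝ)).pow 2).const_mul 3).const_add 1 |>.inv₀
          (by norm_num)
      refine h.congr' ?_
      filter_upwards [eventually_lt_atBot 0] with a ha
      have ha' := ha.ne
      have hp := (stdGaussPdf_pos a).ne'
      have hd : a ^ 2 + 3 ≠ 0 := by positivity
      have hd' : -a ^ 2 - 3 ≠ 0 := fun h => hd (by linarith)
      push_cast
      rw [eq_div_iff]
      · field_simp
        ring
      · have hinv : 0 < a⁻¹ ^ 2 := by positivity
        exact mul_ne_zero (neg_ne_zero.2 (by positivity)) hp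
  refine hlim.congr' ?_
  filter_upwards [eventually_lt_atBot 0] with a ha
  have ha' := ha.ne
  have hp := (stdGaussPdf_pos a).ne'
  simp only [psi]
  simp only [Nat.reduceAdd, zero_add, inv_pow, pow_one]
  field_simp
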